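/- Let s₀ > 0, σ > 0, T > 0 and c₁ ∈ (0, π/T), and define s : [0,T] → ℝ by s(t) = s₀ · cos²(c₁T/2) / cos²(c₁(T−t)/2). Then: (i) s(0) = s₀; (ii) ṡ(T) = 0; (iii) for all t ∈ [0,T], −s̈(t)/s(t)² + ṡ(t)²/s(t)³ = −c₁²/(2 s₀ cos²(c₁T/2)), so s solves the Black–Scholes Euler–Lagrange equation −s̈/s² + ṡ²/s³ = λσ² with λσ² = −c₁²/(2 s₀ cos²(c₁T/2)); (iv) (1/T)∫₀ᵀ s(t) dt = s₀ · sin(c₁T)/(c₁T), so for 0 < K < s₀ the constraint (1/T)∫₀ᵀ s(t) dt = K holds if and only if sin(c₁T)/(c₁T) = K/s₀; and (v) (1/2)∫₀ᵀ (ṡ(t)/(σ s(t)))² dt = (c₁/σ²) · ( tan(c₁T/2) − c₁T/2 ). -/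

import Mathlib

open Real intervalIntegral

lemma hasDerivAt_mul_sub_div_two (c T t : ℝ) :
    HasDerivAt (fun u => c * (T - u) / 2) (-c / 2) t := by
  simpa using (((hasDerivAt_id t).const_sub T).const_mul c).div_const 2

lemma hasDerivAt_div_cos_sq (A c T : ℝ) {t : ℝ} (ht : Real.cos (c * (T - t) / 2) ≠ 0) :
    HasDerivAt (fun u => A / Real.cos (c * (T - u) / 2) ^ 2)
      (-(c * A) * Real.sin (c * (T - t) / 2) / Real.cos (c * (T - t) / 2) ^ 3) t := by
  have h := (hasDerivAt_const t A).fun_div ((hasDerivAt_mul_sub_div_two c T t).cos.fun_pow 2)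
    (pow_ne_zero 2 ht)
  refine h.congr_deriv ?_
  field_simp
  ring

lemma hasDerivAt_mul_sin_div_cos_cube (A c T : ℝ) {t : ℝ}
    (ht : Real.cos (c * (T - t) / 2) ≠ 0) :
    HasDerivAt (fun u => A * Real.sin (c * (T - u) / 2) / Real.cos (c * (T - u) / 2) ^ 3)
      (-(c * A / 2) * (Real.cos (c * (T - t) / 2) ^ 2 + 3 * Real.sin (c * (T - t) / 2) ^ 2) /
        Real.cos (c * (T - t) / 2) ^ 4) t := by
  have hθ := hasDerivAt_mul_sub_div_two c T t
  have h := (hθ.sin.const_mul A).fun_div (hθ.cos.fun_pow 3) (pow_ne_zero 3 ht)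
  refine h.congr_deriv ?_
  field_simp
  ring

lemma deriv_deriv_div_cos_sq (A c T : ℝ) {t : ℝ} (ht : Real.cos (c * (T - t) / 2) ≠ 0) :
    deriv (deriv fun u => A / Real.cos (c * (T - u) / 2) ^ 2) t =
      c ^ 2 * A / 2 * (Real.cos (c * (T - t) / 2) ^ 2 + 3 * Real.sin (c * (T - t) / 2) ^ 2) /
        Real.cos (c * (T - t) / 2) ^ 4 := by
  have hcont : Continuous fun u => Real.cos (c * (T - u) / 2) := by fun_prop
  have hev : (deriv fun u => A / Real.cos (c * (T - u) / 2) ^ 2) =ᶠ[nhds t]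
      fun u => -(c * A) * Real.sin (c * (T - u) / 2) / Real.cos (c * (T - u) / 2) ^ 3 := by
    filter_upwards [hcont.continuousAt.eventually_ne ht] with u hu
    exact (hasDerivAt_div_cos_sq A c T hu).deriv
  rw [hev.deriv_eq, (hasDerivAt_mul_sin_div_cos_cube (-(c * A)) c T ht).deriv]
  ring

lemma hasDerivAt_tan_mul_sub_div_two {c T t : ℝ} (hc : c ≠ 0)
    (ht : Real.cos (c * (T - t) / 2) ≠ 0) :
    HasDerivAt (fun u => -(2 / c) * Real.tan (c * (T - u) / 2))
      (1 / Real.cos (c * (T - t) / 2) ^ 2) t := by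
  have h := ((Real.hasDerivAt_tan ht).comp t (hasDerivAt_mul_sub_div_two c T t)).const_mul
    (-(2 / c))
  refine h.congr_deriv ?_
  field_simp

lemma intervalIntegrable_one_div_cos_sq {c T : ℝ}
    (hcos : ∀ t ∈ Set.uIcc 0 T, Real.cos (c * (T - t) / 2) ≠ 0) :
    IntervalIntegrable (fun t => 1 / Real.cos (c * (T - t) / 2) ^ 2) MeasureTheory.volume 0 T := by
  apply ContinuousOn.intervalIntegrable
  exact continuousOn_const.div (by fun_prop) fun t ht => pow_ne_zero 2 (hcos t ht)

lemma integral_one_div_cos_sq {c T : ℝ} (hc : c ≠ 0)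
    (hcos : ∀ t ∈ Set.uIcc 0 T, Real.cos (c * (T - t) / 2) ≠ 0) :
    ∫ t in (0 : ℝ)..T, 1 / Real.cos (c * (T - t) / 2) ^ 2 = 2 / c * Real.tan (c * T / 2) := by
  rw [integral_eq_sub_of_hasDerivAt (fun t ht => hasDerivAt_tan_mul_sub_div_two hc (hcos t ht))
    (intervalIntegrable_one_div_cos_sq hcos)]
  simp

/-- **The most-likely-path of the in-the-money Asian call in the Black–Scholes model**
`a(s,t) = σs`: the path `s(t) = s₀ cos²(c₁T/2)/cos²(c₁(T-t)/2)` with `0 < c₁ < π/T`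
satisfies `s(0) = s₀`, `ṡ(T) = 0`, the Euler–Lagrange equation
`-s̈/s² + ṡ²/s³ = -c₁²/(2 s₀ cos²(c₁T/2))`, the average identity
`(1/T)∫₀ᵀ s = s₀ sin(c₁T)/(c₁T)` (so the constraint holds iff
`sin(c₁T)/(c₁T) = K/s₀` for `0 < K < s₀`), and its action equals
`(c₁/σ²)(tan(c₁T/2) - c₁T/2)`. -/
theorem blackScholes_most_likely_path_itm (s₀ σ T c₁ : ℝ) (hs₀ : 0 < s₀) (hσ : 0 < σ)
    (hT : 0 < T) (hc₁ : 0 < c₁) (hc₁T : c₁ < Real.pi / T) (s : ℝ → ℝ)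
    (hs : ∀ t, s t = s₀ * Real.cos (c₁ * T / 2) ^ 2 / Real.cos (c₁ * (T - t) / 2) ^ 2) :
    s 0 = s₀ ∧
    deriv s T = 0 ∧
    (∀ t ∈ Set.Icc (0 : ℝ) T,
      -(deriv (deriv s) t) / (s t) ^ 2 + (deriv s t) ^ 2 / (s t) ^ 3 =
        -(c₁ ^ 2) / (2 * s₀ * Real.cos (c₁ * T / 2) ^ 2)) ∧
    (1 / T) * ∫ t in (0 : ℝ)..T, s t = s₀ * Real.sin (c₁ * T) / (c₁ * T) ∧
    (∀ K : ℝ, 0 < K → K < s₀ →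
      ((1 / T) * ∫ t in (0 : ℝ)..T, s t = K ↔ Real.sin (c₁ * T) / (c₁ * T) = K / s₀)) ∧
    (1 / 2) * ∫ t in (0 : ℝ)..T, (deriv s t / (σ * s t)) ^ 2 =
      c₁ / σ ^ 2 * (Real.tan (c₁ * T / 2) - c₁ * T / 2) := by
  have hcos : ∀ t ∈ Set.Icc (0 : ℝ) T, 0 < Real.cos (c₁ * (T - t) / 2) := by
    intro t ht
    have hπ : c₁ * T < Real.pi := (lt_div_iff₀ hT).mp hc₁T
    have h₀ : 0 ≤ c₁ * (T - t) := mul_nonneg hc₁.le (sub_nonneg.mpr ht.2)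
    have h₁ : 0 ≤ c₁ * t := mul_nonneg hc₁.le ht.1
    exact Real.cos_pos_of_mem_Ioo ⟨by linarith [Real.pi_pos], by linarith⟩
  have hC : 0 < Real.cos (c₁ * T / 2) := by simpa using hcos 0 ⟨le_rfl, hT.le⟩
  have hcos_ne : ∀ t ∈ Set.uIcc 0 T, Real.cos (c₁ * (T - t) / 2) ≠ 0 := by
    rw [Set.uIcc_of_le hT.le]
    exact fun t ht => (hcos t ht).ne'
  obtain rfl : s = fun t =>
      s₀ * Real.cos (c₁ * T / 2) ^ 2 / Real.cos (c₁ * (T - t) / 2) ^ 2 := funext hs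
  have hderiv := fun t ht =>
    (hasDerivAt_div_cos_sq (s₀ * Real.cos (c₁ * T / 2) ^ 2) c₁ T (hcos t ht).ne').deriv
  have havg : (1 / T) * ∫ t in (0 : ℝ)..T,
      s₀ * Real.cos (c₁ * T / 2) ^ 2 / Real.cos (c₁ * (T - t) / 2) ^ 2 =
        s₀ * Real.sin (c₁ * T) / (c₁ * T) := by
    have hsin : Real.sin (c₁ * T) = 2 * Real.sin (c₁ * T / 2) * Real.cos (c₁ * T / 2) := by
      rw [← Real.sin_two_mul, mul_div_cancel₀ _ two_ne_zero]
    simp_rw [div_eq_mul_one_div (s₀ * Real.cos (c₁ * T / 2) ^ 2)]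
    rw [integral_const_mul, integral_one_div_cos_sq hc₁.ne' hcos_ne, hsin, Real.tan_eq_sin_div_cos]
    field_simp
  refine ⟨?_, ?_, fun t ht => ?_, havg, fun K _ _ => ?_, ?_⟩
  · simp [hC.ne']
  · simp [hderiv T ⟨hT.le, le_rfl⟩]
  · have hct := (hcos t ht).ne'
    rw [hderiv t ht, deriv_deriv_div_cos_sq _ _ _ hct]
    have hsq := Real.sin_sq_add_cos_sq (c₁ * (T - t) / 2)
    field_simp
    linear_combination -hsq
  · rw [havg, eq_div_iff hs₀.ne', mul_div_assoc, mul_comm s₀]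
  · have hint : Set.EqOn
        (fun t => (deriv (fun u =>
          s₀ * Real.cos (c₁ * T / 2) ^ 2 / Real.cos (c₁ * (T - u) / 2) ^ 2) t /
          (σ * (s₀ * Real.cos (c₁ * T / 2) ^ 2 / Real.cos (c₁ * (T - t) / 2) ^ 2))) ^ 2)
        (fun t => c₁ ^ 2 / σ ^ 2 * (1 / Real.cos (c₁ * (T - t) / 2) ^ 2 - 1))
        (Set.uIcc 0 T) := by
      intro t ht
      have hct := hcos_ne t ht
      rw [Set.uIcc_of_le hT.le] at ht
      have hsq := Real.sin_sq_add_cos_sq (c₁ * (T - t) / 2)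
      simp only [hderiv t ht]
      field_simp
      linear_combination hsq
    rw [integral_congr hint, integral_const_mul,
      integral_sub (intervalIntegrable_one_div_cos_sq hcos_ne) intervalIntegrable_const,
      integral_one_div_cos_sq hc₁.ne' hcos_ne, integral_const, smul_eq_mul]
    field_simp
    ring
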